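/- arXiv:2512.13964 — 2 statements merged into one kernel-verified Lean document; each statement's English description precedes it below -/
import Mathlib

section
/- Assume cᵢ ≥ 0 and ℓᵢ > 0 for i = 1,2,3, the ordering condition (Ω′), c₂/ℓ₂ < 1, and c₃/ℓ₃ ≥ 1. Then Vol₄(P_H(c,ℓ)) = (8/3)·ℓ₁²ℓ₂²ℓ₃²·(c₂/ℓ₂ + 2c₃/ℓ₃ + 2). -/
open MeasureTheory

/-- The convex hull of the graph of the trilinear monomial `x₁x₂x₃` over the box
`[c₁-ℓ₁, c₁+ℓ₁] × [c₂-ℓ₂, c₂+ℓ₂] × [c₃-ℓ₃, c₃+ℓ₃]`, viewed in `ℝ⁴`. -/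
noncomputable def PH (c₁ c₂ c₃ ℓ₁ ℓ₂ ℓ₃ : ℝ) : Set (Fin 4 → ℝ) :=
  convexHull ℝ {p : Fin 4 → ℝ | ∃ x₁ x₂ x₃ : ℝ,
    x₁ ∈ Set.Icc (c₁ - ℓ₁) (c₁ + ℓ₁) ∧ x₂ ∈ Set.Icc (c₂ - ℓ₂) (c₂ + ℓ₂) ∧
    x₃ ∈ Set.Icc (c₃ - ℓ₃) (c₃ + ℓ₃) ∧ p = ![x₁ * x₂ * x₃, x₁, x₂, x₃]}

/-- The trilinear polynomial `xyw + p yw + q xw + r xy`. -/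
def trilin (p q r x y w : ℝ) : ℝ := x * y * w + p * y * w + q * x * w + r * x * y

/-- The upper envelope of `trilin p q r` over the unit cube, for nonpositive `p`, `q` and
nonnegative `r`, `1 + p + q`. -/
def upperEnv (p q r x y w : ℝ) : ℝ :=
  r * min x y + (1 + p + q) * min (min x y) w
    + q * max 0 (x + w - y - 1) + p * max 0 (y + w - x - 1)

/-- The lower envelope of `trilin p q r`, obtained from an upper envelope by reflecting `x`. -/
def lowerEnv (p q r x y w : ℝ) : ℝ :=
  q * w + r * y - upperEnv (-1 - p) q r (1 - x) y w

lemma max_zero_add_sub_one_le {x y w : ℝ} (hx : x ∈ Set.Icc (0 : ℝ) 1)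
    (hy : y ∈ Set.Icc (0 : ℝ) 1) (hw : w ∈ Set.Icc (0 : ℝ) 1) :
    max 0 (y + w - x - 1) ≤ y * w * (1 - x) := by
  obtain ⟨hx0, hx1⟩ := hx
  obtain ⟨hy0, hy1⟩ := hy
  obtain ⟨hw0, hw1⟩ := hw
  refine max_le (mul_nonneg (mul_nonneg hy0 hw0) (by linarith)) ?_
  nlinarith [mul_nonneg (sub_nonneg.2 hy1) (sub_nonneg.2 hw1),
    mul_nonneg hx0 (sub_nonneg.2 (mul_le_one₀ hy1 hw0 hw1))]

lemma trilin_le_upperEnv {p q r x y w : ℝ} (hp : p ≤ 0) (hq : q ≤ 0) (hr : 0 ≤ r)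
    (hpq : 0 ≤ 1 + p + q) (hx : x ∈ Set.Icc (0 : ℝ) 1) (hy : y ∈ Set.Icc (0 : ℝ) 1)
    (hw : w ∈ Set.Icc (0 : ℝ) 1) : trilin p q r x y w ≤ upperEnv p q r x y w := by
  have h₁ := mul_le_mul_of_nonpos_left (max_zero_add_sub_one_le hx hy hw) hp
  have h₂ := mul_le_mul_of_nonpos_left (max_zero_add_sub_one_le hy hx hw) hq
  obtain ⟨hx0, hx1⟩ := hx
  obtain ⟨hy0, hy1⟩ := hy
  obtain ⟨hw0, hw1⟩ := hw
  have hxy : x * y ≤ min x y :=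
    le_min (mul_le_of_le_one_right hx0 hy1) (mul_le_of_le_one_left hy0 hx1)
  have hxyw : x * y * w ≤ min (min x y) w :=
    le_min ((mul_le_of_le_one_right (mul_nonneg hx0 hy0) hw1).trans hxy)
      (mul_le_of_le_one_left hw0 (mul_le_one₀ hx1 hy0 hy1))
  have h₃ := mul_le_mul_of_nonneg_left hxy hr
  have h₄ := mul_le_mul_of_nonneg_left hxyw hpq
  unfold trilin upperEnv
  linarith

lemma trilin_reflect (p q r x y w : ℝ) :
    trilin p q r x y w = q * w + r * y - trilin (-1 - p) q r (1 - x) y w := by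
  unfold trilin
  ring

lemma lowerEnv_le_trilin {p q r x y w : ℝ} (hp : -1 ≤ p) (hq : q ≤ 0) (hr : 0 ≤ r)
    (hpq : p ≤ q) (hx : x ∈ Set.Icc (0 : ℝ) 1) (hy : y ∈ Set.Icc (0 : ℝ) 1)
    (hw : w ∈ Set.Icc (0 : ℝ) 1) : lowerEnv p q r x y w ≤ trilin p q r x y w := by
  rw [trilin_reflect, lowerEnv]
  have := trilin_le_upperEnv (p := -1 - p) (x := 1 - x) (by linarith) hq hr (by linarith)
    (by simpa [and_comm] using hx) hy hw
  linarith

/-- The convex hull of the graph of `trilin p q r` over the unit cube. -/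
def trilinHull (p q r : ℝ) : Set (Fin 4 → ℝ) :=
  convexHull ℝ {v | ∃ x ∈ Set.Icc (0 : ℝ) 1, ∃ y ∈ Set.Icc (0 : ℝ) 1,
    ∃ w ∈ Set.Icc (0 : ℝ) 1, v = ![trilin p q r x y w, x, y, w]}

lemma convex_trilinHull (p q r : ℝ) : Convex ℝ (trilinHull p q r) := convex_convexHull ℝ _

lemma trilin_mem_trilinHull (p q r : ℝ) {x y w : ℝ} (hx : x ∈ Set.Icc (0 : ℝ) 1)
    (hy : y ∈ Set.Icc (0 : ℝ) 1) (hw : w ∈ Set.Icc (0 : ℝ) 1) :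
    ![trilin p q r x y w, x, y, w] ∈ trilinHull p q r :=
  subset_convexHull ℝ _ ⟨x, hx, y, hy, w, hw, rfl⟩

lemma Convex.add_three_smul_mem {E : Type*} [AddCommGroup E] [Module ℝ E] {K : Set E}
    (hK : Convex ℝ K) {u v w : E} (hu : u ∈ K) (hv : v ∈ K) (hw : w ∈ K) {a b c : ℝ}
    (ha : 0 ≤ a) (hb : 0 ≤ b) (hc : 0 ≤ c)
    (h : a + b + c = 1) : a • u + b • v + c • w ∈ K := by
  have := hK.sum_mem (t := Finset.univ) (w := ![a, b, c]) (z := ![u, v, w])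
    (by simp [Fin.forall_fin_succ, ha, hb, hc]) (by simpa [Fin.sum_univ_three] using h)
    (by simp [Fin.forall_fin_succ, hu, hv, hw])
  simpa [Fin.sum_univ_three] using this

lemma exists_mem_Icc_mul_eq {a b : ℝ} (hb : 0 ≤ b) (h : b ≤ a) :
    ∃ s ∈ Set.Icc (0 : ℝ) 1, a * s = b := by
  rcases hb.eq_or_lt with rfl | hb
  · exact ⟨0, by simp, by simp⟩
  · have ha := hb.trans_le h
    exact ⟨b / a, ⟨by positivity, (div_le_one ha).2 h⟩, by field_simp⟩

lemma upperEnv_mem {p q r x y w : ℝ} (hx : x ∈ Set.Icc (0 : ℝ) 1)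
    (hy : y ∈ Set.Icc (0 : ℝ) 1) (hw : w ∈ Set.Icc (0 : ℝ) 1) :
    ![upperEnv p q r x y w, x, y, w] ∈ trilinHull p q r := by
  obtain ⟨hx0, hx1⟩ := hx
  obtain ⟨hy0, hy1⟩ := hy
  obtain ⟨hw0, hw1⟩ := hw
  have h0 : (0 : ℝ) ∈ Set.Icc (0 : ℝ) 1 := by simp
  have h1 : (1 : ℝ) ∈ Set.Icc (0 : ℝ) 1 := by simp
  have hK := convex_trilinHull p q r
  rcases le_total y x with h | h
  · obtain ⟨s, hs, hs'⟩ := exists_mem_Icc_mul_eq (a := y) (b := min y w) (by positivity)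
      (min_le_left _ _)
    obtain ⟨t, ht, ht'⟩ := exists_mem_Icc_mul_eq (a := x - y) (b := max 0 (x + w - y - 1))
      (le_max_left _ _) (max_le (by linarith) (by linarith))
    obtain ⟨u, hu, hu'⟩ := exists_mem_Icc_mul_eq (a := 1 - x)
      (b := w - min y w - max 0 (x + w - y - 1))
      (by grind) (by grind)
    convert hK.add_three_smul_mem (trilin_mem_trilinHull p q r h1 h1 hs)
      (trilin_mem_trilinHull p q r h0 h0 hu) (trilin_mem_trilinHull p q r h1 h0 ht)
      hy0 (sub_nonneg.2 hx1) (sub_nonneg.2 h) (by ring) using 1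
    have h2 : max 0 (y + w - x - 1) = 0 := max_eq_left (by linarith)
    ext i
    fin_cases i
    · simp only [upperEnv, trilin, min_eq_right h, h2, Fin.zero_eta, Matrix.cons_val_zero,
        Pi.add_apply, Pi.smul_apply, smul_eq_mul]
      linear_combination (-1 - p - q) * hs' - q * ht'
    · simp
    · simp
    · simp
      linear_combination - hs' - ht' - hu'
  · obtain ⟨s, hs, hs'⟩ := exists_mem_Icc_mul_eq (a := x) (b := min x w) (by positivity)
      (min_le_left _ _)
    obtain ⟨t, ht, ht'⟩ := exists_mem_Icc_mul_eq (a := y - x) (b := max 0 (y + w - x - 1))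
      (le_max_left _ _) (max_le (by linarith) (by linarith))
    obtain ⟨u, hu, hu'⟩ := exists_mem_Icc_mul_eq (a := 1 - y)
      (b := w - min x w - max 0 (y + w - x - 1))
      (by grind) (by grind)
    convert hK.add_three_smul_mem (trilin_mem_trilinHull p q r h1 h1 hs)
      (trilin_mem_trilinHull p q r h0 h0 hu) (trilin_mem_trilinHull p q r h0 h1 ht)
      hx0 (sub_nonneg.2 hy1) (sub_nonneg.2 h) (by ring) using 1
    have h2 : max 0 (x + w - y - 1) = 0 := max_eq_left (by linarith)
    ext i
    fin_cases i
    · simp only [upperEnv, trilin, min_eq_left h, h2, Fin.zero_eta, Matrix.cons_val_zero,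
        Pi.add_apply, Pi.smul_apply, smul_eq_mul]
      linear_combination (-1 - p - q) * hs' - p * ht'
    · simp
    · simp
    · simp
      linear_combination - hs' - ht' - hu'

lemma lowerEnv_mem {p q r x y w : ℝ} (hx : x ∈ Set.Icc (0 : ℝ) 1)
    (hy : y ∈ Set.Icc (0 : ℝ) 1) (hw : w ∈ Set.Icc (0 : ℝ) 1) :
    ![lowerEnv p q r x y w, x, y, w] ∈ trilinHull p q r := by
  have hconv : Convex ℝ {v : Fin 4 → ℝ |
      ![q * v 3 + r * v 2 - v 0, 1 - v 1, v 2, v 3] ∈ trilinHull p q r} := by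
    intro v hv u hu a b ha hb hab
    have := convex_trilinHull p q r hv hu ha hb hab
    simp only [Set.mem_ofPred_eq]
    convert this using 1
    ext i
    fin_cases i
    · simp
      ring
    · simp
      linear_combination - hab
    · simp
    · simp
  have hsub : trilinHull (-1 - p) q r ⊆ {v : Fin 4 → ℝ |
      ![q * v 3 + r * v 2 - v 0, 1 - v 1, v 2, v 3] ∈ trilinHull p q r} := by
    refine convexHull_min ?_ hconv
    rintro v ⟨x, hx, y, hy, w, hw, rfl⟩
    have := trilin_mem_trilinHull p q r (x := 1 - x) (by simpa [and_comm] using hx) hy hw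
    rw [trilin_reflect] at this
    simpa using this
  have := hsub (upperEnv_mem (p := -1 - p) (q := q) (r := r) (x := 1 - x)
    (by simpa [and_comm] using hx) hy hw)
  simpa [lowerEnv] using this

lemma concaveOn_upperEnv {p q r : ℝ} (hp : p ≤ 0) (hq : q ≤ 0) (hr : 0 ≤ r)
    (hpq : 0 ≤ 1 + p + q) {E : Type*} [AddCommGroup E] [Module ℝ E] (f g h : E →ᵃ[ℝ] ℝ) :
    ConcaveOn ℝ Set.univ (fun v => upperEnv p q r (f v) (g v) (h v)) := by
  have key (k : E →ᵃ[ℝ] ℝ) : ConcaveOn ℝ Set.univ (fun v => k v) :=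
    ⟨convex_univ, fun x _ y _ a b _ _ hab => (Convex.combo_affine_apply hab).ge⟩
  have key' (k : E →ᵃ[ℝ] ℝ) : ConvexOn ℝ Set.univ (fun v => k v) :=
    ⟨convex_univ, fun x _ y _ a b _ _ hab => (Convex.combo_affine_apply hab).le⟩
  have hmin := (key f).inf (key g)
  have h0 : ConvexOn ℝ Set.univ (fun _ : E => (0 : ℝ)) := convexOn_const 0 convex_univ
  have h₁ := (h0.sup (key' (f + h - g - AffineMap.const ℝ E 1))).neg.smul (neg_nonneg.2 hq)
  have h₂ := (h0.sup (key' (g + h - f - AffineMap.const ℝ E 1))).neg.smul (neg_nonneg.2 hp)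
  refine ((((hmin.smul hr).add ((hmin.inf (key h)).smul hpq)).add h₁).add h₂).congr fun v _ => ?_
  simp [upperEnv]

lemma trilinHull_eq {p q r : ℝ} (hp0 : -1 ≤ p) (hp1 : p ≤ 0) (hq : q ≤ 0) (hr : 0 ≤ r)
    (h₁ : 0 ≤ 1 + p + q) (h₂ : p ≤ q) :
    trilinHull p q r = {v : Fin 4 → ℝ | v 1 ∈ Set.Icc (0 : ℝ) 1 ∧ v 2 ∈ Set.Icc (0 : ℝ) 1 ∧
      v 3 ∈ Set.Icc (0 : ℝ) 1 ∧
      v 0 ∈ Set.Icc (lowerEnv p q r (v 1) (v 2) (v 3)) (upperEnv p q r (v 1) (v 2) (v 3))} := by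
  apply Set.Subset.antisymm
  · refine convexHull_min ?_ ?_
    · rintro v ⟨x, hx, y, hy, w, hw, rfl⟩
      exact ⟨hx, hy, hw, lowerEnv_le_trilin hp0 hq hr h₂ hx hy hw,
        trilin_le_upperEnv hp1 hq hr h₁ hx hy hw⟩
    · let π (i : Fin 4) : (Fin 4 → ℝ) →ᵃ[ℝ] ℝ :=
        (LinearMap.proj (R := ℝ) (φ := fun _ : Fin 4 => ℝ) i).toAffineMap
      have hI (i : Fin 4) : Convex ℝ {v : Fin 4 → ℝ | v i ∈ Set.Icc (0 : ℝ) 1} :=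
        (convex_Icc (0 : ℝ) 1).affine_preimage (π i)
      have hU := concaveOn_upperEnv hp1 hq hr h₁ (π 1) (π 2) (π 3)
      have hL := concaveOn_upperEnv (p := -1 - p) (by linarith) hq hr (by linarith)
        (AffineMap.const ℝ _ 1 - π 1) (π 2) (π 3)
      have hU' : Convex ℝ {v : Fin 4 → ℝ | v 0 ≤ upperEnv p q r (v 1) (v 2) (v 3)} := by
        intro v hv u hu a b ha hb hab
        have := hU.2 (Set.mem_univ v) (Set.mem_univ u) ha hb hab
        refine le_trans ?_ this
        exact add_le_add (mul_le_mul_of_nonneg_left hv ha) (mul_le_mul_of_nonneg_left hu hb)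
      have hL' : Convex ℝ {v : Fin 4 → ℝ | lowerEnv p q r (v 1) (v 2) (v 3) ≤ v 0} := by
        intro v hv u hu a b ha hb hab
        have := hL.2 (Set.mem_univ v) (Set.mem_univ u) ha hb hab
        have hv' := mul_le_mul_of_nonneg_left hv ha
        have hu' := mul_le_mul_of_nonneg_left hu hb
        simp only [π, lowerEnv, smul_eq_mul, AffineMap.coe_sub, AffineMap.coe_const,
          LinearMap.coe_toAffineMap, Pi.sub_apply, Function.const_apply, LinearMap.proj_apply,
          Set.mem_ofPred_eq, Pi.add_apply, Pi.smul_apply] at this hv' hu' ⊢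
        linarith
      exact (hI 1).inter ((hI 2).inter ((hI 3).inter (hL'.inter hU')))
  · rintro v ⟨hx, hy, hw, hl, hu⟩
    have hl' := lowerEnv_mem (p := p) (q := q) (r := r) hx hy hw
    have hu' := upperEnv_mem (p := p) (q := q) (r := r) hx hy hw
    obtain ⟨a, b, ha, hb, hab, h⟩ := Icc_subset_segment ⟨hl, hu⟩
    convert convex_trilinHull p q r hl' hu' ha hb hab using 1
    simp only [smul_eq_mul] at h
    ext i
    fin_cases i
    · simp [← h]
    · simp
      linear_combination - (v 1) * hab
    · simp
      linear_combination - (v 2) * hab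
    · simp
      linear_combination - (v 3) * hab

lemma continuous_upperEnv (p q r : ℝ) :
    Continuous fun v : ℝ × ℝ × ℝ => upperEnv p q r v.1 v.2.1 v.2.2 := by
  unfold upperEnv
  fun_prop

lemma continuous_lowerEnv (p q r : ℝ) :
    Continuous fun v : ℝ × ℝ × ℝ => lowerEnv p q r v.1 v.2.1 v.2.2 := by
  unfold lowerEnv upperEnv
  fun_prop

lemma integral_cubic (a b k₀ k₁ k₂ k₃ : ℝ) :
    ∫ x in a..b, (k₀ + k₁ * x + k₂ * x ^ 2 + k₃ * x ^ 3) =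
      k₀ * (b - a) + k₁ * (b ^ 2 - a ^ 2) / 2 + k₂ * (b ^ 3 - a ^ 3) / 3
        + k₃ * (b ^ 4 - a ^ 4) / 4 := by
  have hd (x : ℝ) : HasDerivAt (fun x => k₀ * x + k₁ * (x ^ 2 / 2) + k₂ * (x ^ 3 / 3)
      + k₃ * (x ^ 4 / 4)) (k₀ + k₁ * x + k₂ * x ^ 2 + k₃ * x ^ 3) x := by
    have := ((((hasDerivAt_id x).const_mul k₀).add
      (((hasDerivAt_pow 2 x).div_const 2).const_mul k₁)).add
      (((hasDerivAt_pow 3 x).div_const 3).const_mul k₂)).add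
      (((hasDerivAt_pow 4 x).div_const 4).const_mul k₃)
    refine this.congr_deriv ?_
    norm_num
  rw [intervalIntegral.integral_eq_sub_of_hasDerivAt (fun x _ => hd x)
    ((by fun_prop : Continuous _).intervalIntegrable a b)]
  ring

lemma integral_piecewise_cubic {f : ℝ → ℝ} (hf : Continuous f) {t : ℝ}
    (ht : t ∈ Set.Icc (0 : ℝ) 1) (a₀ a₁ a₂ a₃ b₀ b₁ b₂ b₃ : ℝ)
    (ha : ∀ x ∈ Set.Icc 0 t, f x = a₀ + a₁ * x + a₂ * x ^ 2 + a₃ * x ^ 3)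
    (hb : ∀ x ∈ Set.Icc t 1, f x = b₀ + b₁ * x + b₂ * x ^ 2 + b₃ * x ^ 3) :
    ∫ x in (0 : ℝ)..1, f x =
      a₀ * t + a₁ * t ^ 2 / 2 + a₂ * t ^ 3 / 3 + a₃ * t ^ 4 / 4
        + (b₀ * (1 - t) + b₁ * (1 - t ^ 2) / 2 + b₂ * (1 - t ^ 3) / 3
          + b₃ * (1 - t ^ 4) / 4) := by
  rw [← intervalIntegral.integral_add_adjacent_intervals (hf.intervalIntegrable 0 t)
      (hf.intervalIntegrable t 1),
    intervalIntegral.integral_congr (a := 0) (f := f)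
      (g := fun x => a₀ + a₁ * x + a₂ * x ^ 2 + a₃ * x ^ 3)
      (by rw [Set.uIcc_of_le ht.1]; exact ha),
    intervalIntegral.integral_congr (f := f) (g := fun x => b₀ + b₁ * x + b₂ * x ^ 2 + b₃ * x ^ 3)
      (by rw [Set.uIcc_of_le ht.2]; exact hb), integral_cubic, integral_cubic]
  ring

lemma integral_min {t : ℝ} (ht : t ∈ Set.Icc (0 : ℝ) 1) :
    ∫ w in (0 : ℝ)..1, min t w = t - t ^ 2 / 2 := by
  rw [integral_piecewise_cubic (by fun_prop) ht 0 1 0 0 t 0 0 0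
    (fun x hx => by rw [min_eq_right hx.2]; ring) (fun x hx => by rw [min_eq_left hx.1]; ring)]
  ring

lemma integral_max_zero_add_sub_one {x y : ℝ} (hx : x ∈ Set.Icc (0 : ℝ) 1)
    (hy : y ∈ Set.Icc (0 : ℝ) 1) :
    ∫ w in (0 : ℝ)..1, max 0 (x + w - y - 1) = max 0 (x - y) ^ 2 / 2 := by
  obtain ⟨hx0, hx1⟩ := hx
  obtain ⟨hy0, hy1⟩ := hy
  rcases le_total x y with h | h
  · rw [integral_piecewise_cubic (t := 1) (by fun_prop) (by simp) 0 0 0 0 0 0 0 0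
      (fun w hw => by rw [max_eq_left (by linarith [hw.2])]; ring)
      (fun w hw => by rw [max_eq_left (by linarith [hw.2])]; ring), max_eq_left (by linarith)]
    ring
  · rw [integral_piecewise_cubic (t := 1 - x + y) (by fun_prop) ⟨by linarith, by linarith⟩
      0 0 0 0 (x - y - 1) 1 0 0
      (fun w hw => by rw [max_eq_left (by linarith [hw.2])]; ring)
      (fun w hw => by rw [max_eq_right (by linarith [hw.1])]; ring), max_eq_right (by linarith)]
    ring

lemma integral_upperEnv_third (p q r : ℝ) {x y : ℝ} (hx : x ∈ Set.Icc (0 : ℝ) 1)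
    (hy : y ∈ Set.Icc (0 : ℝ) 1) :
    ∫ w in (0 : ℝ)..1, upperEnv p q r x y w =
      r * min x y + (1 + p + q) * (min x y - min x y ^ 2 / 2)
        + q * (max 0 (x - y) ^ 2 / 2) + p * (max 0 (y - x) ^ 2 / 2) := by
  unfold upperEnv
  have hi {f : ℝ → ℝ} (hf : Continuous f) : IntervalIntegrable f volume 0 1 :=
    hf.intervalIntegrable 0 1
  rw [intervalIntegral.integral_add (hi (by fun_prop)) (hi (by fun_prop)),
    intervalIntegral.integral_add (hi (by fun_prop)) (hi (by fun_prop)),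
    intervalIntegral.integral_add (hi (by fun_prop)) (hi (by fun_prop)),
    intervalIntegral.integral_const_mul, intervalIntegral.integral_const_mul,
    intervalIntegral.integral_const_mul, intervalIntegral.integral_const_mul,
    integral_max_zero_add_sub_one hx hy,
    integral_max_zero_add_sub_one hy hx,
    integral_min ⟨le_min hx.1 hy.1, (min_le_left _ _).trans hx.2⟩]
  simp

lemma integral_upperEnv_second (p q r : ℝ) {x : ℝ} (hx : x ∈ Set.Icc (0 : ℝ) 1) :
    ∫ y in (0 : ℝ)..1, ∫ w in (0 : ℝ)..1, upperEnv p q r x y w =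
      r * (x - x ^ 2 / 2) + (1 + p + q) * (x - x ^ 2 + x ^ 3 / 3) + q * x ^ 3 / 6
        + p * (1 - x) ^ 3 / 6 := by
  rw [intervalIntegral.integral_congr (g := fun y => r * min x y
      + (1 + p + q) * (min x y - min x y ^ 2 / 2)
      + q * (max 0 (x - y) ^ 2 / 2) + p * (max 0 (y - x) ^ 2 / 2))
      (by
        rw [Set.uIcc_of_le zero_le_one]
        exact fun y hy => integral_upperEnv_third p q r hx hy),
    integral_piecewise_cubic (by fun_prop) hx
      (q * x ^ 2 / 2) (r + (1 + p + q) - q * x) (-(1 + p + q) / 2 + q / 2) 0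
      (r * x + (1 + p + q) * (x - x ^ 2 / 2) + p * x ^ 2 / 2) (-p * x) (p / 2) 0
      (fun y hy => by
        rw [min_eq_right hy.2, max_eq_right (sub_nonneg.2 hy.2), max_eq_left (sub_nonpos.2 hy.2)]
        ring)
      (fun y hy => by
        rw [min_eq_left hy.1, max_eq_left (sub_nonpos.2 hy.1), max_eq_right (sub_nonneg.2 hy.1)]
        ring)]
  ring

lemma integral_upperEnv_sub_lowerEnv_second (p q r : ℝ) {x : ℝ} (hx : x ∈ Set.Icc (0 : ℝ) 1) :
    ∫ y in (0 : ℝ)..1, ∫ w in (0 : ℝ)..1, (upperEnv p q r x y w - lowerEnv p q r x y w) =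
      -p / 6 + (r + 1 + p / 2 + q / 2) * x + (-r - 1 - p / 2 - q / 2) * x ^ 2
        + (1 + 2 * p) / 6 * x ^ 3 := by
  have hx' : 1 - x ∈ Set.Icc (0 : ℝ) 1 := by simpa [and_comm] using hx
  have hc (p z : ℝ) : Continuous fun v : ℝ × ℝ => upperEnv p q r z v.1 v.2 :=
    (continuous_upperEnv p q r).comp (by fun_prop : Continuous fun v : ℝ × ℝ => (z, v.1, v.2))
  have hw (p z y : ℝ) : IntervalIntegrable (fun w => upperEnv p q r z y w) volume 0 1 :=
    ((hc p z).comp (by fun_prop : Continuous fun w : ℝ => (y, w))).intervalIntegrable 0 1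
  have hy (p z : ℝ) : IntervalIntegrable (fun y => ∫ w in (0 : ℝ)..1, upperEnv p q r z y w)
      volume 0 1 :=
    (intervalIntegral.continuous_parametric_intervalIntegral_of_continuous' (hc p z) 0 1
      ).intervalIntegrable 0 1
  have inner (y : ℝ) :
      ∫ w in (0 : ℝ)..1, (upperEnv p q r x y w - lowerEnv p q r x y w) =
        (∫ w in (0 : ℝ)..1, upperEnv p q r x y w)
          + (∫ w in (0 : ℝ)..1, upperEnv (-1 - p) q r (1 - x) y w)
          - (q / 2 + r * y + 0 * y ^ 2 + 0 * y ^ 3) := by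
    have hlin : ∫ w in (0 : ℝ)..1, (r * y + q * w + 0 * w ^ 2 + 0 * w ^ 3) = q / 2 + r * y := by
      rw [integral_cubic]
      ring
    have hlin' : IntervalIntegrable (fun w : ℝ => r * y + q * w + 0 * w ^ 2 + 0 * w ^ 3)
        volume 0 1 := (by fun_prop : Continuous _).intervalIntegrable 0 1
    rw [zero_mul, zero_mul, add_zero, add_zero, ← hlin,
      ← intervalIntegral.integral_add (hw _ _ _) (hw _ _ _),
      ← intervalIntegral.integral_sub ((hw _ _ _).add (hw _ _ _)) hlin']
    congr 1
    funext w
    simp only [lowerEnv]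
    ring
  simp only [inner]
  rw [intervalIntegral.integral_sub ((hy _ _).add (hy _ _))
      ((by fun_prop : Continuous _).intervalIntegrable 0 1),
    intervalIntegral.integral_add (hy _ _) (hy _ _), integral_cubic,
    integral_upperEnv_second p q r hx, integral_upperEnv_second (-1 - p) q r hx']
  ring

lemma integral_upperEnv_sub_lowerEnv (p q r : ℝ) :
    ∫ x in (0 : ℝ)..1, ∫ y in (0 : ℝ)..1, ∫ w in (0 : ℝ)..1,
      (upperEnv p q r x y w - lowerEnv p q r x y w) = r / 6 + q / 12 + 5 / 24 := by
  rw [intervalIntegral.integral_congr (fun x hx =>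
      integral_upperEnv_sub_lowerEnv_second p q r (by rwa [Set.uIcc_of_le zero_le_one] at hx)),
    integral_cubic]
  ring

lemma measurePreserving_fin_four :
    MeasurePreserving (fun v : Fin 4 → ℝ => (v 0, v 1, v 2, v 3)) volume volume := by
  have h₄ := volume_preserving_piFinSuccAbove (fun _ : Fin 4 => ℝ) 0
  have h₃ := volume_preserving_piFinSuccAbove (fun _ : Fin 3 => ℝ) 0
  have h₂ := volume_preserving_finTwoArrow ℝ
  have hid := MeasurePreserving.id (volume : Measure ℝ)
  exact (hid.prod ((hid.prod h₂).comp h₃)).comp h₄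

lemma volume_trilinHull {p q r : ℝ} (hp0 : -1 ≤ p) (hp1 : p ≤ 0) (hq : q ≤ 0) (hr : 0 ≤ r)
    (h₁ : 0 ≤ 1 + p + q) (h₂ : p ≤ q) :
    volume (trilinHull p q r) = ENNReal.ofReal (r / 6 + q / 12 + 5 / 24) := by
  let Q : Set (ℝ × ℝ × ℝ) := Set.Icc 0 1 ×ˢ Set.Icc 0 1 ×ˢ Set.Icc 0 1
  let L : ℝ × ℝ × ℝ → ℝ := fun v => lowerEnv p q r v.1 v.2.1 v.2.2
  let U : ℝ × ℝ × ℝ → ℝ := fun v => upperEnv p q r v.1 v.2.1 v.2.2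
  let R : Set (ℝ × ℝ × ℝ × ℝ) := {v | v.2 ∈ Q ∧ v.1 ∈ Set.Icc (L v.2) (U v.2)}
  have hL : Continuous L := continuous_lowerEnv p q r
  have hU : Continuous U := continuous_upperEnv p q r
  have hQc : IsCompact Q := isCompact_Icc.prod (isCompact_Icc.prod isCompact_Icc)
  have hQ : MeasurableSet Q := hQc.measurableSet
  have hR : MeasurableSet R := by
    refine IsClosed.measurableSet ?_
    exact (hQc.isClosed.preimage continuous_snd).inter
      ((isClosed_le (hL.comp continuous_snd) continuous_fst).inter
        (isClosed_le continuous_fst (hU.comp continuous_snd)))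
  have hpre : trilinHull p q r = (fun v : Fin 4 → ℝ => (v 0, v 1, v 2, v 3)) ⁻¹' R := by
    rw [trilinHull_eq hp0 hp1 hq hr h₁ h₂]
    ext v
    simp only [R, Q, L, U, Set.mem_preimage, Set.mem_ofPred_eq, Set.mem_prod, and_assoc]
  have hUL : IntegrableOn (fun v => U v - L v) Q :=
    (hU.sub hL).continuousOn.integrableOn_compact hQc
  have hnn : ∀ v ∈ Q, 0 ≤ U v - L v := fun v hv => sub_nonneg.2 <|
    (lowerEnv_le_trilin hp0 hq hr h₂ hv.1 hv.2.1 hv.2.2).trans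
      (trilin_le_upperEnv hp1 hq hr h₁ hv.1 hv.2.1 hv.2.2)
  have hslice (y : ℝ × ℝ × ℝ) : volume ((fun z => (z, y)) ⁻¹' R) =
      Q.indicator (fun v => ENNReal.ofReal (U v - L v)) y := by
    by_cases hy : y ∈ Q
    · rw [Set.indicator_of_mem hy, ← Real.volume_Icc]
      congr 1
      ext z
      simp [R, hy]
    · rw [Set.indicator_of_notMem hy]
      convert measure_empty (μ := (volume : Measure ℝ))
      ext z
      simp [R, hy]
  rw [hpre, measurePreserving_fin_four.measure_preimage hR.nullMeasurableSet,
    Measure.volume_eq_prod, Measure.prod_apply_symm hR]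
  simp only [hslice]
  rw [lintegral_indicator hQ, ← ofReal_integral_eq_lintegral_ofReal hUL
    ((ae_restrict_iff' hQ).2 (Filter.Eventually.of_forall hnn)),
    ← integral_upperEnv_sub_lowerEnv p q r]
  congr 1
  have hUL' (x : ℝ) : IntegrableOn (fun v => U (x, v) - L (x, v))
      (Set.Icc (0 : ℝ) 1 ×ˢ Set.Icc (0 : ℝ) 1) (volume.prod volume) :=
    ((hU.sub hL).comp (by fun_prop : Continuous fun v : ℝ × ℝ => (x, v))
      ).continuousOn.integrableOn_compact (isCompact_Icc.prod isCompact_Icc)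
  simp only [intervalIntegral.integral_of_le zero_le_one, ← integral_Icc_eq_integral_Ioc]
  rw [Measure.volume_eq_prod] at hUL ⊢
  rw [setIntegral_prod _ hUL]
  refine integral_congr_ae (Filter.Eventually.of_forall fun x => ?_)
  exact setIntegral_prod _ (hUL' x)

lemma PH_eq_image (p q r ℓ₁ ℓ₂ ℓ₃ : ℝ) (hℓ₁ : 0 < ℓ₁) (hℓ₂ : 0 < ℓ₂) (hℓ₃ : 0 < ℓ₃) :
    PH ((2 * p + 1) * ℓ₁) ((2 * q + 1) * ℓ₂) ((2 * r + 1) * ℓ₃) ℓ₁ ℓ₂ ℓ₃ =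
      (fun v => v + ![8 * ℓ₁ * ℓ₂ * ℓ₃ * (p * q * r), 2 * ℓ₁ * p, 2 * ℓ₂ * q, 2 * ℓ₃ * r]) ''
        (Matrix.toLin' !![8 * ℓ₁ * ℓ₂ * ℓ₃, 8 * ℓ₁ * ℓ₂ * ℓ₃ * (q * r),
          8 * ℓ₁ * ℓ₂ * ℓ₃ * (p * r), 8 * ℓ₁ * ℓ₂ * ℓ₃ * (p * q);
          0, 2 * ℓ₁, 0, 0; 0, 0, 2 * ℓ₂, 0; 0, 0, 0, 2 * ℓ₃] '' trilinHull p q r) := by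
  rw [trilinHull, LinearMap.image_convexHull]
  have h := AffineMap.image_convexHull
    (AffineMap.id ℝ (Fin 4 → ℝ) + AffineMap.const ℝ (Fin 4 → ℝ)
    ![8 * ℓ₁ * ℓ₂ * ℓ₃ * (p * q * r), 2 * ℓ₁ * p, 2 * ℓ₂ * q, 2 * ℓ₃ * r])
  refine Eq.trans ?_ (h _).symm
  rw [PH]
  congr 1
  ext v
  simp only [Set.mem_image, Set.mem_ofPred_eq, exists_exists_and_eq_and]
  have key (x y w : ℝ) : (AffineMap.id ℝ (Fin 4 → ℝ) + AffineMap.const ℝ (Fin 4 → ℝ)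
      ![8 * ℓ₁ * ℓ₂ * ℓ₃ * (p * q * r), 2 * ℓ₁ * p, 2 * ℓ₂ * q, 2 * ℓ₃ * r])
      (Matrix.toLin' !![8 * ℓ₁ * ℓ₂ * ℓ₃, 8 * ℓ₁ * ℓ₂ * ℓ₃ * (q * r),
          8 * ℓ₁ * ℓ₂ * ℓ₃ * (p * r), 8 * ℓ₁ * ℓ₂ * ℓ₃ * (p * q);
          0, 2 * ℓ₁, 0, 0; 0, 0, 2 * ℓ₂, 0; 0, 0, 0, 2 * ℓ₃] ![trilin p q r x y w, x, y, w]) =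
      ![2 * ℓ₁ * (p + x) * (2 * ℓ₂ * (q + y)) * (2 * ℓ₃ * (r + w)), 2 * ℓ₁ * (p + x),
        2 * ℓ₂ * (q + y), 2 * ℓ₃ * (r + w)] := by
    ext i
    fin_cases i <;> simp [trilin] <;> ring
  have hcoord {ℓ p x : ℝ} (hℓ : 0 < ℓ)
      (hx : x ∈ Set.Icc ((2 * p + 1) * ℓ - ℓ) ((2 * p + 1) * ℓ + ℓ)) :
      ∃ y ∈ Set.Icc (0 : ℝ) 1, 2 * ℓ * (p + y) = x := by
    refine ⟨x / (2 * ℓ) - p, ⟨?_, ?_⟩, by field_simp; ring⟩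
    · rw [sub_nonneg, le_div_iff₀ (by positivity)]
      linarith [hx.1]
    · rw [sub_le_iff_le_add, div_le_iff₀ (by positivity)]
      linarith [hx.2]
  have hcoord' {ℓ p y : ℝ} (hℓ : 0 < ℓ) (hy : y ∈ Set.Icc (0 : ℝ) 1) :
      2 * ℓ * (p + y) ∈ Set.Icc ((2 * p + 1) * ℓ - ℓ) ((2 * p + 1) * ℓ + ℓ) := by
    constructor <;> nlinarith [hy.1, hy.2]
  constructor
  · rintro ⟨x₁, x₂, x₃, h₁, h₂, h₃, rfl⟩
    obtain ⟨x, hx, rfl⟩ := hcoord hℓ₁ h₁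
    obtain ⟨y, hy, rfl⟩ := hcoord hℓ₂ h₂
    obtain ⟨w, hw, rfl⟩ := hcoord hℓ₃ h₃
    exact ⟨_, ⟨x, hx, y, hy, w, hw, rfl⟩, key x y w⟩
  · rintro ⟨_, ⟨x, hx, y, hy, w, hw, rfl⟩, rfl⟩
    exact ⟨_, _, _, hcoord' hℓ₁ hx, hcoord' hℓ₂ hy, hcoord' hℓ₃ hw, key x y w⟩

theorem volume_PH_case3 (c₁ c₂ c₃ ℓ₁ ℓ₂ ℓ₃ : ℝ)
    (hc₁ : 0 ≤ c₁) (hc₂ : 0 ≤ c₂) (hc₃ : 0 ≤ c₃)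
    (hℓ₁ : 0 < ℓ₁) (hℓ₂ : 0 < ℓ₂) (hℓ₃ : 0 < ℓ₃)
    (hΩ₁ : c₁ / ℓ₁ ≤ c₂ / ℓ₂) (hΩ₂ : c₂ / ℓ₂ ≤ c₃ / ℓ₃)
    (h₁ : c₂ / ℓ₂ < 1) (h₂ : 1 ≤ c₃ / ℓ₃) :
    volume (PH c₁ c₂ c₃ ℓ₁ ℓ₂ ℓ₃) =
      ENNReal.ofReal (8 / 3 * ℓ₁ ^ 2 * ℓ₂ ^ 2 * ℓ₃ ^ 2 *
        (c₂ / ℓ₂ + 2 * (c₃ / ℓ₃) + 2)) := by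
  have ht₁ : 0 ≤ c₁ / ℓ₁ := by positivity
  obtain ⟨p, hp⟩ : ∃ p, 2 * p + 1 = c₁ / ℓ₁ := ⟨(c₁ / ℓ₁ - 1) / 2, by ring⟩
  obtain ⟨q, hq⟩ : ∃ q, 2 * q + 1 = c₂ / ℓ₂ := ⟨(c₂ / ℓ₂ - 1) / 2, by ring⟩
  obtain ⟨r, hr⟩ : ∃ r, 2 * r + 1 = c₃ / ℓ₃ := ⟨(c₃ / ℓ₃ - 1) / 2, by ring⟩
  have hc₁' : c₁ = (2 * p + 1) * ℓ₁ := by rw [hp]; field_simp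
  have hc₂' : c₂ = (2 * q + 1) * ℓ₂ := by rw [hq]; field_simp
  have hc₃' : c₃ = (2 * r + 1) * ℓ₃ := by rw [hr]; field_simp
  rw [← hp] at ht₁ hΩ₁
  rw [← hq] at hΩ₁ h₁ ⊢
  rw [← hr] at h₂ ⊢
  rw [hc₁', hc₂', hc₃', PH_eq_image p q r ℓ₁ ℓ₂ ℓ₃ hℓ₁ hℓ₂ hℓ₃, Set.image_add_right,
    measure_preimage_add_right, Measure.addHaar_image_linearMap, LinearMap.det_toLin',
    volume_trilinHull (by linarith) (by linarith) (by linarith) (by linarith) (by linarith)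
      (by linarith), ← ENNReal.ofReal_mul (abs_nonneg _)]
  have hdet : Matrix.det !![8 * ℓ₁ * ℓ₂ * ℓ₃, 8 * ℓ₁ * ℓ₂ * ℓ₃ * (q * r),
      8 * ℓ₁ * ℓ₂ * ℓ₃ * (p * r), 8 * ℓ₁ * ℓ₂ * ℓ₃ * (p * q);
      0, 2 * ℓ₁, 0, 0; 0, 0, 2 * ℓ₂, 0; 0, 0, 0, 2 * ℓ₃] = 64 * ℓ₁ ^ 2 * ℓ₂ ^ 2 * ℓ₃ ^ 2 := by
    simp [Matrix.det_succ_row_zero, Fin.sum_univ_succ]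
    ring
  rw [hdet, abs_of_nonneg (by positivity)]
  congr 1
  ring
end

section
/- Assume cᵢ ≥ 0 and ℓᵢ > 0 for i = 1,2,3, the ordering condition (Ω′), c₃/ℓ₃ < 1, c₁/ℓ₁ + c₂/ℓ₂ + c₃/ℓ₃ ≥ 1, and c₂/ℓ₂ + c₃/ℓ₃ ≥ 1 + c₁/ℓ₁. Then Vol₄(P_H(c,ℓ)) = (8/3)·ℓ₁²ℓ₂²ℓ₃²·(c₂/ℓ₂ + c₃/ℓ₃ + 3). -/
open MeasureTheory

/-- The piecewise linear interpolation on the unit cube of the corner values of `f`. -/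
noncomputable def diagEnv {E : Type*} [AddCommGroup E] [Module ℝ E]
    (f : ℝ → ℝ → ℝ → E) (x y z : ℝ) : E :=
  min x (min y z) • f 1 1 1 + max (x + y - z - 1) 0 • f 1 1 0
  + max (x + z - y - 1) 0 • f 1 0 1 + max (y + z - x - 1) 0 • f 0 1 1
  + (x - min x (min y z) - max (x + y - z - 1) 0 - max (x + z - y - 1) 0) • f 1 0 0
  + (y - min x (min y z) - max (x + y - z - 1) 0 - max (y + z - x - 1) 0) • f 0 1 0
  + (z - min x (min y z) - max (x + z - y - 1) 0 - max (y + z - x - 1) 0) • f 0 0 1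
  + (1 - (x + y + z) + 2 * min x (min y z) + max (x + y - z - 1) 0
      + max (x + z - y - 1) 0 + max (y + z - x - 1) 0) • f 0 0 0

theorem diagEnv_mem {E : Type*} [AddCommGroup E] [Module ℝ E] {C : Set E} (hC : Convex ℝ C)
    {f : ℝ → ℝ → ℝ → E} (hf : ∀ x ∈ Set.Icc (0 : ℝ) 1, ∀ y ∈ Set.Icc (0 : ℝ) 1,
      ∀ z ∈ Set.Icc (0 : ℝ) 1, f x y z ∈ C) {x y z : ℝ}
    (hx : x ∈ Set.Icc (0 : ℝ) 1) (hy : y ∈ Set.Icc (0 : ℝ) 1) (hz : z ∈ Set.Icc (0 : ℝ) 1) :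
    diagEnv f x y z ∈ C := by
  have h0 : (0 : ℝ) ∈ Set.Icc (0 : ℝ) 1 := by simp
  have h1 : (1 : ℝ) ∈ Set.Icc (0 : ℝ) 1 := by simp
  obtain ⟨hx0, hx1⟩ := hx
  obtain ⟨hy0, hy1⟩ := hy
  obtain ⟨hz0, hz1⟩ := hz
  set m := min x (min y z) with hm
  set p := max (x + y - z - 1) 0 with hp
  set q := max (x + z - y - 1) 0 with hq
  set r := max (y + z - x - 1) 0 with hr
  have hw : 0 ≤ m ∧ 0 ≤ p ∧ 0 ≤ q ∧ 0 ≤ r ∧ 0 ≤ x - m - p - q ∧ 0 ≤ y - m - p - r ∧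
      0 ≤ z - m - q - r ∧ 0 ≤ 1 - (x + y + z) + 2 * m + p + q + r := by
    clear hf
    refine ⟨?_, ?_, ?_, ?_, ?_, ?_, ?_, ?_⟩ <;> grind
  have := hC.sum_mem (t := Finset.univ)
    (w := ![m, p, q, r, x - m - p - q, y - m - p - r, z - m - q - r,
      1 - (x + y + z) + 2 * m + p + q + r])
    (z := ![f 1 1 1, f 1 1 0, f 1 0 1, f 0 1 1, f 1 0 0, f 0 1 0, f 0 0 1, f 0 0 0])
    (by simpa [Fin.forall_fin_succ] using hw) (by simp [Fin.sum_univ_succ]; ring)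
    (by simp [Fin.forall_fin_succ, hf, h0, h1])
  convert this using 1
  simp only [diagEnv, ← hm, ← hp, ← hq, ← hr]
  simp [Fin.sum_univ_succ]
  abel

theorem diagEnv_eq (f : ℝ → ℝ → ℝ → ℝ) (x y z : ℝ) :
    diagEnv f x y z = f 0 0 0 + (f 1 0 0 - f 0 0 0) * x + (f 0 1 0 - f 0 0 0) * y
      + (f 0 0 1 - f 0 0 0) * z
      + (2 * f 0 0 0 + f 1 1 1 - f 1 0 0 - f 0 1 0 - f 0 0 1) * min x (min y z)
      - (f 1 0 0 + f 0 1 0 - f 0 0 0 - f 1 1 0) * max (x + y - z - 1) 0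
      - (f 1 0 0 + f 0 0 1 - f 0 0 0 - f 1 0 1) * max (x + z - y - 1) 0
      - (f 0 1 0 + f 0 0 1 - f 0 0 0 - f 0 1 1) * max (y + z - x - 1) 0 := by
  simp only [diagEnv, smul_eq_mul]
  ring

/-- The inequalities on the corner values making `diagEnv f` concave. -/
structure DiagConcave (f : ℝ → ℝ → ℝ → ℝ) : Prop where
  diag : f 1 0 0 + f 0 1 0 + f 0 0 1 ≤ 2 * f 0 0 0 + f 1 1 1
  xy : f 0 0 0 + f 1 1 0 ≤ f 1 0 0 + f 0 1 0
  xz : f 0 0 0 + f 1 0 1 ≤ f 1 0 0 + f 0 0 1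
  yz : f 0 0 0 + f 0 1 1 ≤ f 0 1 0 + f 0 0 1

theorem DiagConcave.le_diagEnv_combo {f : ℝ → ℝ → ℝ → ℝ} (hf : DiagConcave f)
    {a b : ℝ} (ha : 0 ≤ a) (hb : 0 ≤ b) (hab : a + b = 1) (x y z x' y' z' : ℝ) :
    a * diagEnv f x y z + b * diagEnv f x' y' z' ≤
      diagEnv f (a * x + b * x') (a * y + b * y') (a * z + b * z') := by
  have relu (s t : ℝ) : max (a * s + b * t) 0 ≤ a * max s 0 + b * max t 0 :=
    max_le (by gcongr <;> exact le_max_left _ _) (by positivity)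
  have hmin : a * min x (min y z) + b * min x' (min y' z') ≤
      min (a * x + b * x') (min (a * y + b * y') (a * z + b * z')) := by
    refine le_min ?_ (le_min ?_ ?_) <;> gcongr <;> simp
  have e (s t u s' t' u' : ℝ) : a * s + b * s' + (a * t + b * t') - (a * u + b * u') - 1 =
      a * (s + t - u - 1) + b * (s' + t' - u' - 1) := by
    linear_combination hab
  have h1 := mul_le_mul_of_nonneg_left hmin (sub_nonneg.2 hf.diag)
  have h2 := mul_le_mul_of_nonneg_left (relu (x + y - z - 1) (x' + y' - z' - 1))
    (sub_nonneg.2 hf.xy)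
  have h3 := mul_le_mul_of_nonneg_left (relu (x + z - y - 1) (x' + z' - y' - 1))
    (sub_nonneg.2 hf.xz)
  have h4 := mul_le_mul_of_nonneg_left (relu (y + z - x - 1) (y' + z' - x' - 1))
    (sub_nonneg.2 hf.yz)
  simp only [diagEnv_eq, e]
  obtain rfl : b = 1 - a := by linarith
  linarith

theorem DiagConcave.le_diagEnv {a₁ a₂ a₃ d₁ d₂ d₃ : ℝ} {f : ℝ → ℝ → ℝ → ℝ} (hf : DiagConcave f)
    (hprod : ∀ x y z, f x y z = (a₁ + d₁ * x) * (a₂ + d₂ * y) * (a₃ + d₃ * z)) {x y z : ℝ}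
    (hx : x ∈ Set.Icc (0 : ℝ) 1) (hy : y ∈ Set.Icc (0 : ℝ) 1) (hz : z ∈ Set.Icc (0 : ℝ) 1) :
    f x y z ≤ diagEnv f x y z := by
  have key {s t u : ℝ} (hs : s ∈ Set.Icc (0 : ℝ) 1) (ht : t ∈ Set.Icc (0 : ℝ) 1)
      (hu : u ∈ Set.Icc (0 : ℝ) 1) : max (s + t - u - 1) 0 ≤ s * t - s * t * u := by
    obtain ⟨hs0, hs1⟩ := hs
    obtain ⟨ht0, ht1⟩ := ht
    obtain ⟨hu0, hu1⟩ := hu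
    have h := mul_nonneg (sub_nonneg.2 hs1) (sub_nonneg.2 ht1)
    have h' : s * t ≤ 1 := mul_le_one₀ hs1 ht0 ht1
    refine max_le ?_ ?_
    · nlinarith
    · nlinarith [mul_nonneg hs0 ht0]
  have hmin : x * y * z ≤ min x (min y z) := by
    obtain ⟨hx0, hx1⟩ := hx
    obtain ⟨hy0, hy1⟩ := hy
    obtain ⟨hz0, hz1⟩ := hz
    have h1 := mul_nonneg hx0 hy0
    have h2 : x * y ≤ 1 := mul_le_one₀ hx1 hy0 hy1
    refine le_min ?_ (le_min ?_ ?_)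
    · calc x * y * z ≤ x * 1 * 1 := by gcongr
        _ = x := by ring
    · calc x * y * z ≤ 1 * y * 1 := by gcongr
        _ = y := by ring
    · calc x * y * z ≤ 1 * z := by gcongr
        _ = z := by ring
  have h1 := mul_le_mul_of_nonneg_left hmin (sub_nonneg.2 hf.diag)
  have h2 := mul_le_mul_of_nonneg_left (key hx hy hz) (sub_nonneg.2 hf.xy)
  have h3 := mul_le_mul_of_nonneg_left (key hx hz hy) (sub_nonneg.2 hf.xz)
  have h4 := mul_le_mul_of_nonneg_left (key hy hz hx) (sub_nonneg.2 hf.yz)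
  rw [diagEnv_eq]
  simp only [hprod] at *
  linarith

@[fun_prop]
theorem Continuous.diagEnv {X : Type*} [TopologicalSpace X] (f : ℝ → ℝ → ℝ → ℝ) {g h k : X → ℝ}
    (hg : Continuous g) (hh : Continuous h) (hk : Continuous k) :
    Continuous fun t => diagEnv f (g t) (h t) (k t) := by
  unfold _root_.diagEnv
  fun_prop
theorem setIntegral_Icc_fin_succ {n : ℕ} {G : (Fin (n + 1) → ℝ) → ℝ} (hG : Continuous G) :
    ∫ v in Set.Icc (0 : Fin (n + 1) → ℝ) 1, G v =
      ∫ x in (0 : ℝ)..1, ∫ v in Set.Icc (0 : Fin n → ℝ) 1, G (Fin.cons x v) := by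
  have mp := (volume_preserving_piFinSuccAbove (fun _ : Fin (n + 1) => ℝ) 0).symm
  rw [← mp.setIntegral_preimage_emb (MeasurableEquiv.measurableEmbedding _)]
  have hpre : (MeasurableEquiv.piFinSuccAbove (fun _ : Fin (n + 1) => ℝ) 0).symm ⁻¹'
      Set.Icc (0 : Fin (n + 1) → ℝ) 1 = Set.Icc (0 : ℝ) 1 ×ˢ Set.Icc (0 : Fin n → ℝ) 1 := by
    ext ⟨x, v⟩
    simp [MeasurableEquiv.piFinSuccAbove, Pi.le_def, Fin.forall_fin_succ, Fin.insertNthEquiv]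
  have hfun (p : ℝ × (Fin n → ℝ)) :
      (MeasurableEquiv.piFinSuccAbove (fun _ : Fin (n + 1) => ℝ) 0).symm p =
        Fin.cons p.1 p.2 := by
    simp [MeasurableEquiv.piFinSuccAbove, Fin.insertNthEquiv]
  simp only [hpre, hfun]
  rw [Measure.volume_eq_prod, setIntegral_prod, integral_Icc_eq_integral_Ioc,
    ← intervalIntegral.integral_of_le zero_le_one]
  refine ContinuousOn.integrableOn_compact (isCompact_Icc.prod isCompact_Icc) ?_
  exact (hG.comp (by fun_prop)).continuousOn

theorem setIntegral_Icc_fin_three {g : ℝ → ℝ → ℝ → ℝ}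
    (hg : Continuous fun v : Fin 3 → ℝ => g (v 0) (v 1) (v 2)) :
    ∫ v in Set.Icc (0 : Fin 3 → ℝ) 1, g (v 0) (v 1) (v 2) =
      ∫ x in (0 : ℝ)..1, ∫ y in (0 : ℝ)..1, ∫ z in (0 : ℝ)..1, g x y z := by
  rw [setIntegral_Icc_fin_succ hg]
  congr! 3 with x
  refine (setIntegral_Icc_fin_succ (G := fun v => g x (v 0) (v 1)) ?_).trans ?_
  · exact hg.comp (f := fun v : Fin 2 → ℝ => ![x, v 0, v 1]) (by fun_prop)
  congr! 3 with y
  refine (setIntegral_Icc_fin_succ (G := fun v => g x y (v 0)) ?_).trans ?_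
  · exact hg.comp (f := fun v : Fin 1 → ℝ => ![x, y, v 0]) (by fun_prop)
  congr! 3 with z
  have huniv : Set.Icc (0 : Fin 0 → ℝ) 1 = Set.univ :=
    Set.eq_univ_of_forall fun v => ⟨fun i => i.elim0, fun i => i.elim0⟩
  rw [huniv]
  simp [volume_pi, measureReal_def]

theorem volume_region_fin_succ {n : ℕ} {L U : (Fin n → ℝ) → ℝ} (hL : Continuous L)
    (hU : Continuous U) (hLU : ∀ v ∈ Set.Icc (0 : Fin n → ℝ) 1, L v ≤ U v) :
    volume {p : Fin (n + 1) → ℝ | Fin.tail p ∈ Set.Icc (0 : Fin n → ℝ) 1 ∧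
      p 0 ∈ Set.Icc (L (Fin.tail p)) (U (Fin.tail p))} =
      ENNReal.ofReal (∫ v in Set.Icc (0 : Fin n → ℝ) 1, (U v - L v)) := by
  have mp := volume_preserving_piFinSuccAbove (fun _ : Fin (n + 1) => ℝ) 0
  set R : Set (ℝ × (Fin n → ℝ)) := {p | p.2 ∈ Set.Icc (0 : Fin n → ℝ) 1 ∧
      p.1 ∈ Set.Icc (L p.2) (U p.2)} with hR
  have hRm : MeasurableSet R := by
    refine IsClosed.measurableSet ?_
    refine IsClosed.inter (isClosed_Icc.preimage continuous_snd) ?_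
    exact (isClosed_le (hL.comp continuous_snd) continuous_fst).inter
      (isClosed_le continuous_fst (hU.comp continuous_snd))
  have hpre : {p : Fin (n + 1) → ℝ | Fin.tail p ∈ Set.Icc (0 : Fin n → ℝ) 1 ∧
      p 0 ∈ Set.Icc (L (Fin.tail p)) (U (Fin.tail p))} =
      MeasurableEquiv.piFinSuccAbove (fun _ : Fin (n + 1) => ℝ) 0 ⁻¹' R := by
    ext p
    simp [hR, MeasurableEquiv.piFinSuccAbove, Fin.insertNthEquiv]
  rw [hpre, mp.measure_preimage hRm.nullMeasurableSet, Measure.volume_eq_prod,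
    Measure.prod_apply_symm hRm, ofReal_integral_eq_lintegral_ofReal,
    ← lintegral_indicator measurableSet_Icc]
  · refine lintegral_congr fun v => ?_
    by_cases hv : v ∈ Set.Icc (0 : Fin n → ℝ) 1
    · have : (fun x : ℝ => (x, v)) ⁻¹' R = Set.Icc (L v) (U v) := by
        ext x
        simp only [hR, Set.mem_preimage, Set.mem_ofPred_eq, hv, true_and]
      rw [this, Set.indicator_of_mem hv, Real.volume_Icc]
    · have : (fun x : ℝ => (x, v)) ⁻¹' R = ∅ := by
        ext x
        simp only [hR, Set.mem_preimage, Set.mem_ofPred_eq, hv, false_and, Set.mem_empty_iff_false]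
      rw [this, Set.indicator_of_notMem hv, measure_empty]
  · exact (hU.sub hL).continuousOn.integrableOn_compact isCompact_Icc
  · exact (ae_restrict_iff' measurableSet_Icc).2
      (Filter.Eventually.of_forall fun v hv => sub_nonneg.2 (hLU v hv))
theorem hasDerivAt_max_zero_pow (n : ℕ) (x : ℝ) :
    HasDerivAt (fun t : ℝ => max t 0 ^ (n + 2) / (n + 2)) (max x 0 ^ (n + 1)) x := by
  have hpow : HasDerivAt (fun t : ℝ => t ^ (n + 2) / (n + 2)) (x ^ (n + 1)) x := by
    have h := (hasDerivAt_pow (n + 2) x).div_const ((n : ℝ) + 2)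
    push_cast at h
    rwa [mul_div_cancel_left₀ _ (by positivity)] at h
  rcases lt_trichotomy x 0 with hx | rfl | hx
  · rw [max_eq_right hx.le, zero_pow (by omega)]
    refine (hasDerivAt_const x (0 : ℝ)).congr_of_eventuallyEq ?_
    filter_upwards [gt_mem_nhds hx] with t ht
    simp [max_eq_right (le_of_lt ht)]
  · rw [max_self, zero_pow (by omega)]
    rw [zero_pow (by omega)] at hpow
    rw [← hasDerivWithinAt_univ, ← Set.Iic_union_Ici (a := (0 : ℝ))]
    refine ((hasDerivWithinAt_const 0 (Set.Iic 0) (0 : ℝ)).congr ?_ (by simp)).union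
      (hpow.hasDerivWithinAt.congr ?_ (by simp))
    · intro t ht
      simp [max_eq_right (Set.mem_Iic.1 ht)]
    · intro t ht
      simp only [max_eq_left (Set.mem_Ici.1 ht)]
  · rw [max_eq_left hx.le]
    refine hpow.congr_of_eventuallyEq ?_
    filter_upwards [lt_mem_nhds hx] with t ht
    rw [max_eq_left (le_of_lt ht)]

theorem integral_max_zero_pow (n : ℕ) (a b : ℝ) :
    ∫ t in a..b, max t 0 ^ (n + 1) = (max b 0 ^ (n + 2) - max a 0 ^ (n + 2)) / (n + 2) := by
  rw [intervalIntegral.integral_eq_sub_of_hasDerivAt (fun t _ => hasDerivAt_max_zero_pow n t)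
    (Continuous.intervalIntegrable (by fun_prop) _ _)]
  ring

theorem integral_max_add_sub_sub_one :
    ∫ x in (0 : ℝ)..1, ∫ y in (0 : ℝ)..1, ∫ z in (0 : ℝ)..1, max (x + y - z - 1) 0 = 1 / 24 := by
  have hz (x y : ℝ) : ∫ z in (0 : ℝ)..1, max (x + y - z - 1) 0 =
      max (y + (x - 1)) 0 ^ 2 / 2 - max (y + (x - 2)) 0 ^ 2 / 2 := by
    have h := integral_max_zero_pow 0 (x + y - 1 - 1) (x + y - 1 - 0)
    rw [← intervalIntegral.integral_comp_sub_left (fun t => max t 0 ^ (0 + 1))] at h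
    convert h using 1
    · congr! 2 with z
      rw [zero_add, pow_one]
      ring_nf
    · ring_nf
  have hy (x : ℝ) : ∫ y in (0 : ℝ)..1, (max (y + (x - 1)) 0 ^ 2 / 2 - max (y + (x - 2)) 0 ^ 2 / 2) =
      max x 0 ^ 3 / 6 - max (x - 1) 0 ^ 3 / 3 + max (x - 2) 0 ^ 3 / 6 := by
    have h := integral_max_zero_pow 1
    rw [intervalIntegral.integral_sub, intervalIntegral.integral_div, intervalIntegral.integral_div,
      intervalIntegral.integral_comp_add_right (fun t => max t 0 ^ 2),
      intervalIntegral.integral_comp_add_right (fun t => max t 0 ^ 2), h, h]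
    · norm_num
      ring_nf
    all_goals exact Continuous.intervalIntegrable (by fun_prop) _ _
  simp only [hz, hy]
  have h := integral_max_zero_pow 2
  rw [intervalIntegral.integral_add, intervalIntegral.integral_sub, intervalIntegral.integral_div,
    intervalIntegral.integral_div, intervalIntegral.integral_div,
    intervalIntegral.integral_comp_sub_right (fun t => max t 0 ^ 3),
    intervalIntegral.integral_comp_sub_right (fun t => max t 0 ^ 3), h, h, h]
  · norm_num
  all_goals exact Continuous.intervalIntegrable (by fun_prop) _ _

theorem intervalIntegral_swap {h : ℝ → ℝ → ℝ} (hh : Continuous fun p : ℝ × ℝ => h p.1 p.2) :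
    ∫ x in (0 : ℝ)..1, ∫ y in (0 : ℝ)..1, h x y = ∫ y in (0 : ℝ)..1, ∫ x in (0 : ℝ)..1, h x y := by
  refine intervalIntegral_intervalIntegral_swap ?_
  simp only [Set.uIoc_of_le zero_le_one]
  exact (hh.continuousOn.integrableOn_compact (isCompact_Icc.prod isCompact_Icc)).mono_set
    (Set.prod_mono Set.Ioc_subset_Icc_self Set.Ioc_subset_Icc_self)

theorem integral_max_add_sub_sub_one_swap_right :
    ∫ x in (0 : ℝ)..1, ∫ y in (0 : ℝ)..1, ∫ z in (0 : ℝ)..1, max (x + z - y - 1) 0 = 1 / 24 := by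
  rw [← integral_max_add_sub_sub_one]
  congr! 2 with x
  exact intervalIntegral_swap (by fun_prop)

theorem integral_max_add_sub_sub_one_rotate :
    ∫ x in (0 : ℝ)..1, ∫ y in (0 : ℝ)..1, ∫ z in (0 : ℝ)..1, max (y + z - x - 1) 0 = 1 / 24 := by
  rw [← integral_max_add_sub_sub_one_swap_right]
  exact intervalIntegral_swap (intervalIntegral.continuous_parametric_intervalIntegral_of_continuous'
    (f := fun (p : ℝ × ℝ) z => max (p.2 + z - p.1 - 1) 0) (by fun_prop) _ _)

theorem integral_min_min :
    ∫ x in (0 : ℝ)..1, ∫ y in (0 : ℝ)..1, ∫ z in (0 : ℝ)..1, min x (min y z) = 1 / 4 := by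
  have hz {x y : ℝ} (hx : x ∈ Set.uIcc (0 : ℝ) 1) (hy : y ∈ Set.uIcc (0 : ℝ) 1) :
      ∫ z in (0 : ℝ)..1, min x (min y z) =
        y - y ^ 2 / 2 + max (y - x) 0 ^ 2 / 2 - (1 - x) * max (y - x) 0 := by
    rw [Set.uIcc_of_le zero_le_one] at hx hy
    obtain ⟨hx0, hx1⟩ := hx
    obtain ⟨hy0, hy1⟩ := hy
    have h := integral_max_zero_pow 0 (min x y - 1) (min x y - 0)
    rw [← intervalIntegral.integral_comp_sub_left (fun t => max t 0 ^ (0 + 1))] at h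
    have e (z : ℝ) : min x (min y z) = min x y - max (min x y - z) 0 ^ (0 + 1) := by
      rw [zero_add, pow_one]
      clear h
      grind
    simp only [e]
    rw [intervalIntegral.integral_sub, h, max_eq_right (a := min x y - 1)]
    · rcases le_total x y with hxy | hxy
      · rw [min_eq_left hxy, sub_zero, max_eq_left hx0, max_eq_left (sub_nonneg.2 hxy)]
        norm_num
        ring
      · rw [min_eq_right hxy, sub_zero, max_eq_left hy0, max_eq_right (sub_nonpos.2 hxy)]
        norm_num
    · simp [hx1]
    all_goals exact Continuous.intervalIntegrable (by fun_prop) _ _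
  have hy {x : ℝ} (hx : x ∈ Set.uIcc (0 : ℝ) 1) :
      ∫ y in (0 : ℝ)..1, ∫ z in (0 : ℝ)..1, min x (min y z) = 1 / 3 - (1 - x) ^ 3 / 3 := by
    rw [intervalIntegral.integral_congr fun y hy => hz hx hy]
    rw [Set.uIcc_of_le zero_le_one] at hx
    have h0 := integral_max_zero_pow 0
    have h1 := integral_max_zero_pow 1
    simp only [zero_add, pow_one] at h0
    rw [intervalIntegral.integral_sub, intervalIntegral.integral_add,
      intervalIntegral.integral_sub, intervalIntegral.integral_div,
      intervalIntegral.integral_div, intervalIntegral.integral_const_mul,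
      intervalIntegral.integral_comp_sub_right (fun t => max t 0 ^ 2),
      intervalIntegral.integral_comp_sub_right (fun t => max t 0), h0, h1,
      max_eq_left (sub_nonneg.2 hx.2), max_eq_right (a := 0 - x) (by linarith [hx.1]),
      integral_id, integral_pow]
    · norm_num
      ring
    all_goals exact Continuous.intervalIntegrable (by fun_prop) _ _
  rw [intervalIntegral.integral_congr fun x hx => hy hx, intervalIntegral.integral_sub,
    intervalIntegral.integral_div, intervalIntegral.integral_div,
    intervalIntegral.integral_comp_sub_left (fun t => t ^ 3),
    integral_pow]
  · norm_num
  all_goals exact Continuous.intervalIntegrable (by fun_prop) _ _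

theorem setIntegral_diagEnv (f : ℝ → ℝ → ℝ → ℝ) :
    ∫ v in Set.Icc (0 : Fin 3 → ℝ) 1, diagEnv f (v 0) (v 1) (v 2) =
      f 1 1 1 / 4 + (f 1 1 0 + f 1 0 1 + f 0 1 1) / 24 + (f 1 0 0 + f 0 1 0 + f 0 0 1) / 6 +
        f 0 0 0 / 8 := by
  have hx : ∫ v in Set.Icc (0 : Fin 3 → ℝ) 1, v 0 = 1 / 2 := by
    rw [setIntegral_Icc_fin_three (g := fun x _ _ => x) (by fun_prop)]
    norm_num
  have hy : ∫ v in Set.Icc (0 : Fin 3 → ℝ) 1, v 1 = 1 / 2 := by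
    rw [setIntegral_Icc_fin_three (g := fun _ y _ => y) (by fun_prop)]
    norm_num
  have hz : ∫ v in Set.Icc (0 : Fin 3 → ℝ) 1, v 2 = 1 / 2 := by
    rw [setIntegral_Icc_fin_three (g := fun _ _ z => z) (by fun_prop)]
    norm_num
  have h1 : ∫ _ in Set.Icc (0 : Fin 3 → ℝ) 1, f 0 0 0 = f 0 0 0 := by
    rw [setIntegral_Icc_fin_three (g := fun _ _ _ => f 0 0 0) (by fun_prop)]
    norm_num
  have hm : ∫ v in Set.Icc (0 : Fin 3 → ℝ) 1, min (v 0) (min (v 1) (v 2)) = 1 / 4 := by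
    rw [setIntegral_Icc_fin_three (g := fun x y z => min x (min y z)) (by fun_prop),
      integral_min_min]
  have hxy : ∫ v in Set.Icc (0 : Fin 3 → ℝ) 1, max (v 0 + v 1 - v 2 - 1) 0 = 1 / 24 := by
    rw [setIntegral_Icc_fin_three (g := fun x y z => max (x + y - z - 1) 0) (by fun_prop),
      integral_max_add_sub_sub_one]
  have hxz : ∫ v in Set.Icc (0 : Fin 3 → ℝ) 1, max (v 0 + v 2 - v 1 - 1) 0 = 1 / 24 := by
    rw [setIntegral_Icc_fin_three (g := fun x y z => max (x + z - y - 1) 0) (by fun_prop),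
      integral_max_add_sub_sub_one_swap_right]
  have hyz : ∫ v in Set.Icc (0 : Fin 3 → ℝ) 1, max (v 1 + v 2 - v 0 - 1) 0 = 1 / 24 := by
    rw [setIntegral_Icc_fin_three (g := fun x y z => max (y + z - x - 1) 0) (by fun_prop),
      integral_max_add_sub_sub_one_rotate]
  simp only [diagEnv_eq]
  rw [integral_sub, integral_sub, integral_sub, integral_add, integral_add, integral_add,
    integral_add]
  · simp only [integral_const_mul, hx, hy, hz, h1, hm, hxy, hxz, hyz]
    ring
  all_goals exact (Continuous.continuousOn (by fun_prop)).integrableOn_compact isCompact_Icc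

theorem setIntegral_diagEnv_reflect (f : ℝ → ℝ → ℝ → ℝ) :
    ∫ v in Set.Icc (0 : Fin 3 → ℝ) 1, diagEnv f (1 - v 0) (v 1) (v 2) =
      ∫ v in Set.Icc (0 : Fin 3 → ℝ) 1, diagEnv f (v 0) (v 1) (v 2) := by
  rw [setIntegral_Icc_fin_three (g := diagEnv f) (by fun_prop),
    setIntegral_Icc_fin_three (g := fun x y z => diagEnv f (1 - x) y z) (by fun_prop)]
  simpa using intervalIntegral.integral_comp_sub_left (a := 0) (b := 1)
    (fun x => ∫ y in (0 : ℝ)..1, ∫ z in (0 : ℝ)..1, diagEnv f x y z) 1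

theorem diagEnv_neg (f : ℝ → ℝ → ℝ → ℝ) (x y z : ℝ) :
    diagEnv (fun x y z => -f x y z) x y z = -diagEnv f x y z := by
  simp only [diagEnv_eq]
  ring

theorem diagEnv_vec (f : ℝ → ℝ → ℝ → ℝ) (x y z : ℝ) :
    diagEnv (fun x y z => ![f x y z, x, y, z]) x y z = ![diagEnv f x y z, x, y, z] := by
  ext i
  fin_cases i <;> simp [diagEnv]

theorem diagEnv_vec_reflect (f : ℝ → ℝ → ℝ → ℝ) (x y z : ℝ) :
    diagEnv (fun x y z => ![f x y z, 1 - x, y, z]) (1 - x) y z =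
      ![diagEnv f (1 - x) y z, x, y, z] := by
  ext i
  fin_cases i
  · simp [diagEnv]
  · simp [diagEnv]
    ring
  all_goals simp [diagEnv]

/-- The graph of `f` over the unit cube, as a subset of `ℝ⁴` with the value in coordinate `0`. -/
def cubeGraph (f : ℝ → ℝ → ℝ → ℝ) : Set (Fin 4 → ℝ) :=
  {p | ∃ x ∈ Set.Icc (0 : ℝ) 1, ∃ y ∈ Set.Icc (0 : ℝ) 1, ∃ z ∈ Set.Icc (0 : ℝ) 1,
    p = ![f x y z, x, y, z]}

theorem convexHull_cubeGraph {a₁ a₂ a₃ d₁ d₂ d₃ : ℝ} {f : ℝ → ℝ → ℝ → ℝ}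
    (hprod : ∀ x y z, f x y z = (a₁ + d₁ * x) * (a₂ + d₂ * y) * (a₃ + d₃ * z))
    (hU : DiagConcave f) (hL : DiagConcave fun x y z => -f (1 - x) y z) :
    convexHull ℝ (cubeGraph f) = {p : Fin 4 → ℝ | Fin.tail p ∈ Set.Icc (0 : Fin 3 → ℝ) 1 ∧
      p 0 ∈ Set.Icc (diagEnv (fun x y z => f (1 - x) y z) (1 - Fin.tail p 0) (Fin.tail p 1)
        (Fin.tail p 2)) (diagEnv f (Fin.tail p 0) (Fin.tail p 1) (Fin.tail p 2))} := by
  have hreflect {x : ℝ} (hx : x ∈ Set.Icc (0 : ℝ) 1) : 1 - x ∈ Set.Icc (0 : ℝ) 1 :=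
    ⟨sub_nonneg.2 hx.2, by linarith [hx.1]⟩
  refine (convexHull_min ?_ ?_).antisymm ?_
  · rintro _ ⟨x, hx, y, hy, z, hz, rfl⟩
    have hlow := hL.le_diagEnv (a₁ := -(a₁ + d₁)) (d₁ := d₁) (a₂ := a₂) (d₂ := d₂) (a₃ := a₃)
      (d₃ := d₃) (fun x y z => by rw [hprod]; ring) (hreflect hx) hy hz
    rw [diagEnv_neg (fun x y z => f (1 - x) y z), sub_sub_cancel, neg_le_neg_iff] at hlow
    refine ⟨?_, hlow, hU.le_diagEnv hprod hx hy hz⟩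
    simp only [Set.mem_Icc, Pi.le_def, Fin.forall_fin_succ] at hx hy hz ⊢
    simp [Fin.tail, hx, hy, hz]
  · rintro p ⟨hp, hpL, hpU⟩ q ⟨hq, hqL, hqU⟩ a b ha hb hab
    refine ⟨convex_Icc 0 1 hp hq ha hb hab, ?_, ?_⟩
    · have h := hL.le_diagEnv_combo ha hb hab (1 - Fin.tail p 0) (Fin.tail p 1) (Fin.tail p 2)
        (1 - Fin.tail q 0) (Fin.tail q 1) (Fin.tail q 2)
      have e : a * (1 - Fin.tail p 0) + b * (1 - Fin.tail q 0) =
          1 - (a * Fin.tail p 0 + b * Fin.tail q 0) := by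
        linear_combination hab
      simp only [diagEnv_neg (fun x y z => f (1 - x) y z), e] at h
      have h1 := mul_le_mul_of_nonneg_left hpL ha
      have h2 := mul_le_mul_of_nonneg_left hqL hb
      simp only [Fin.tail, Pi.add_apply, Pi.smul_apply, smul_eq_mul] at h h1 h2 ⊢
      linarith
    · refine le_trans ?_ (hU.le_diagEnv_combo ha hb hab _ _ _ _ _ _)
      simp only [Pi.add_apply, Pi.smul_apply, smul_eq_mul]
      gcongr
      · exact hpU
      · exact hqU
  · rintro p ⟨hp, hpL, hpU⟩
    have hcoord (i : Fin 3) : Fin.tail p i ∈ Set.Icc (0 : ℝ) 1 := ⟨hp.1 i, hp.2 i⟩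
    have hmem {x y z : ℝ} (hx : x ∈ Set.Icc (0 : ℝ) 1) (hy : y ∈ Set.Icc (0 : ℝ) 1)
        (hz : z ∈ Set.Icc (0 : ℝ) 1) : ![f x y z, x, y, z] ∈ convexHull ℝ (cubeGraph f) :=
      subset_convexHull ℝ _ ⟨x, hx, y, hy, z, hz, rfl⟩
    have hup := diagEnv_mem (convex_convexHull ℝ (cubeGraph f))
      (fun x hx y hy z hz => hmem hx hy hz) (hcoord 0) (hcoord 1) (hcoord 2)
    have hlow := diagEnv_mem (convex_convexHull ℝ (cubeGraph f))
      (fun x hx y hy z hz => hmem (hreflect hx) hy hz) (hreflect (hcoord 0)) (hcoord 1) (hcoord 2)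
    rw [diagEnv_vec] at hup
    rw [diagEnv_vec_reflect (fun x y z => f (1 - x) y z)] at hlow
    have hp0 := Set.mem_Icc.2 ⟨hpL, hpU⟩
    rw [← segment_eq_Icc (hpL.trans hpU)] at hp0
    obtain ⟨a, b, ha, hb, hab, h⟩ := hp0
    convert convex_convexHull ℝ (cubeGraph f) hlow hup ha hb hab using 1
    have hsplit (t : ℝ) : t = a * t + b * t := by rw [← add_mul, hab, one_mul]
    ext i
    fin_cases i
    · exact h.symm
    all_goals exact hsplit _

theorem volume_convexHull_cubeGraph {a₁ a₂ a₃ d₁ d₂ d₃ : ℝ} {f : ℝ → ℝ → ℝ → ℝ}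
    (hprod : ∀ x y z, f x y z = (a₁ + d₁ * x) * (a₂ + d₂ * y) * (a₃ + d₃ * z))
    (hU : DiagConcave f) (hL : DiagConcave fun x y z => -f (1 - x) y z) :
    volume (convexHull ℝ (cubeGraph f)) =
      ENNReal.ofReal (5 * (f 1 1 1 - f 0 1 1) / 24 + (f 1 0 0 - f 0 0 0) / 24 +
        (f 0 1 0 + f 0 0 1 - f 1 1 0 - f 1 0 1) / 8) := by
  have hset := convexHull_cubeGraph hprod hU hL
  rw [hset, volume_region_fin_succ
    (L := fun v => diagEnv (fun x y z => f (1 - x) y z) (1 - v 0) (v 1) (v 2))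
    (U := fun v => diagEnv f (v 0) (v 1) (v 2)) (by fun_prop) (by fun_prop), integral_sub,
    setIntegral_diagEnv_reflect, setIntegral_diagEnv, setIntegral_diagEnv]
  · congr 1
    norm_num
    ring
  · exact (Continuous.continuousOn (by fun_prop)).integrableOn_compact isCompact_Icc
  · exact (Continuous.continuousOn (by fun_prop)).integrableOn_compact isCompact_Icc
  · intro v hv
    have hmem : ![f (v 0) (v 1) (v 2), v 0, v 1, v 2] ∈ convexHull ℝ (cubeGraph f) :=
      subset_convexHull ℝ _ ⟨_, ⟨hv.1 0, hv.2 0⟩, _, ⟨hv.1 1, hv.2 1⟩, _, ⟨hv.1 2, hv.2 2⟩, rfl⟩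
    rw [hset] at hmem
    exact hmem.2.1.trans hmem.2.2

open scoped Pointwise in
theorem PH_eq_vadd_image (c₁ c₂ c₃ : ℝ) {ℓ₁ ℓ₂ ℓ₃ : ℝ} (hℓ₁ : 0 < ℓ₁) (hℓ₂ : 0 < ℓ₂)
    (hℓ₃ : 0 < ℓ₃) :
    PH c₁ c₂ c₃ ℓ₁ ℓ₂ ℓ₃ = ![0, c₁ - ℓ₁, c₂ - ℓ₂, c₃ - ℓ₃] +ᵥ
      Matrix.toLin' (Matrix.diagonal ![1, 2 * ℓ₁, 2 * ℓ₂, 2 * ℓ₃]) ''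
        convexHull ℝ (cubeGraph fun x y z =>
          (c₁ - ℓ₁ + 2 * ℓ₁ * x) * (c₂ - ℓ₂ + 2 * ℓ₂ * y) * (c₃ - ℓ₃ + 2 * ℓ₃ * z)) := by
  have hmem {c ℓ x : ℝ} (hℓ : 0 < ℓ) (hx : x ∈ Set.Icc (0 : ℝ) 1) :
      c - ℓ + 2 * ℓ * x ∈ Set.Icc (c - ℓ) (c + ℓ) := by
    constructor <;> nlinarith [hx.1, hx.2]
  have hex {c ℓ x : ℝ} (hℓ : 0 < ℓ) (hx : x ∈ Set.Icc (c - ℓ) (c + ℓ)) :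
      ∃ t ∈ Set.Icc (0 : ℝ) 1, c - ℓ + 2 * ℓ * t = x := by
    refine ⟨(x - (c - ℓ)) / (2 * ℓ), ⟨div_nonneg (sub_nonneg.2 hx.1) (by positivity), ?_⟩, ?_⟩
    · rw [div_le_one (by positivity)]
      linarith [hx.2]
    · field_simp
      ring
  rw [LinearMap.image_convexHull, ← convexHull_vadd, PH]
  congr 1
  have hvec (t x y z : ℝ) : ![0, c₁ - ℓ₁, c₂ - ℓ₂, c₃ - ℓ₃] +ᵥ
      Matrix.toLin' (Matrix.diagonal ![1, 2 * ℓ₁, 2 * ℓ₂, 2 * ℓ₃]) ![t, x, y, z] =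
      ![t, c₁ - ℓ₁ + 2 * ℓ₁ * x, c₂ - ℓ₂ + 2 * ℓ₂ * y, c₃ - ℓ₃ + 2 * ℓ₃ * z] := by
    ext i
    fin_cases i <;> simp [Matrix.mulVec_diagonal]
  ext p
  constructor
  · rintro ⟨x₁, x₂, x₃, h₁, h₂, h₃, rfl⟩
    obtain ⟨x, hx, rfl⟩ := hex hℓ₁ h₁
    obtain ⟨y, hy, rfl⟩ := hex hℓ₂ h₂
    obtain ⟨z, hz, rfl⟩ := hex hℓ₃ h₃
    exact ⟨_, ⟨_, ⟨x, hx, y, hy, z, hz, rfl⟩, rfl⟩, hvec _ _ _ _⟩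
  · rintro ⟨_, ⟨_, ⟨x, hx, y, hy, z, hz, rfl⟩, rfl⟩, rfl⟩
    exact ⟨_, _, _, hmem hℓ₁ hx, hmem hℓ₂ hy, hmem hℓ₃ hz, hvec _ _ _ _⟩

theorem volume_PH_case4 (c₁ c₂ c₃ ℓ₁ ℓ₂ ℓ₃ : ℝ)
    (hc₁ : 0 ≤ c₁) (hc₂ : 0 ≤ c₂) (hc₃ : 0 ≤ c₃)
    (hℓ₁ : 0 < ℓ₁) (hℓ₂ : 0 < ℓ₂) (hℓ₃ : 0 < ℓ₃)
    (hΩ₁ : c₁ / ℓ₁ ≤ c₂ / ℓ₂) (hΩ₂ : c₂ / ℓ₂ ≤ c₃ / ℓ₃)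
    (h₁ : c₃ / ℓ₃ < 1) (h₂ : 1 ≤ c₁ / ℓ₁ + c₂ / ℓ₂ + c₃ / ℓ₃)
    (h₃ : 1 + c₁ / ℓ₁ ≤ c₂ / ℓ₂ + c₃ / ℓ₃) :
    volume (PH c₁ c₂ c₃ ℓ₁ ℓ₂ ℓ₃) =
      ENNReal.ofReal (8 / 3 * ℓ₁ ^ 2 * ℓ₂ ^ 2 * ℓ₃ ^ 2 *
        (c₂ / ℓ₂ + c₃ / ℓ₃ + 3)) := by
  obtain ⟨r₁, rfl⟩ : ∃ r, c₁ = r * ℓ₁ := ⟨c₁ / ℓ₁, by field_simp⟩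
  obtain ⟨r₂, rfl⟩ : ∃ r, c₂ = r * ℓ₂ := ⟨c₂ / ℓ₂, by field_simp⟩
  obtain ⟨r₃, rfl⟩ : ∃ r, c₃ = r * ℓ₃ := ⟨c₃ / ℓ₃, by field_simp⟩
  simp only [mul_div_cancel_right₀ _ hℓ₁.ne', mul_div_cancel_right₀ _ hℓ₂.ne',
    mul_div_cancel_right₀ _ hℓ₃.ne'] at *
  have hr₁ : 0 ≤ r₁ := nonneg_of_mul_nonneg_left hc₁ hℓ₁
  have hpos : 0 < ℓ₁ * ℓ₂ * ℓ₃ := by positivity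
  have scale {t : ℝ} (ht : 0 ≤ t) : 0 ≤ ℓ₁ * ℓ₂ * ℓ₃ * t := mul_nonneg hpos.le ht
  rw [PH_eq_vadd_image _ _ _ hℓ₁ hℓ₂ hℓ₃, measure_vadd, Measure.addHaar_image_linearMap,
    LinearMap.det_toLin', Matrix.det_diagonal, volume_convexHull_cubeGraph (fun _ _ _ => rfl),
    ← ENNReal.ofReal_mul (abs_nonneg _)]
  · congr 1
    simp [Fin.prod_univ_succ, abs_of_pos hℓ₁, abs_of_pos hℓ₂, abs_of_pos hℓ₃]
    ring
  · constructor
    · linarith [scale (t := r₁ + r₂ + r₃ - 1) (by linarith)]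
    · linarith [scale (t := 1 - r₃) (by linarith)]
    · linarith [scale (t := 1 - r₂) (by linarith)]
    · linarith [scale (t := 1 - r₁) (by linarith)]
  · constructor
    · linarith [scale (t := r₂ + r₃ - r₁ - 1) (by linarith)]
    · linarith [scale (t := 1 - r₃) (by linarith)]
    · linarith [scale (t := 1 - r₂) (by linarith)]
    · linarith [scale (t := 1 + r₁) (by linarith)]
end
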